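/- For any semigroup S with finite set of idempotents E, the free idempotent generated semigroup IG(E) satisfies the congruence condition: the relation 𝓡̃ on IG(E) is a left congruence (a 𝓡̃ b implies ca 𝓡̃ cb for all c ∈ IG(E)), and the relation 𝓛̃ on IG(E) is a right congruence (a 𝓛̃ b implies ac 𝓛̃ bc for all c ∈ IG(E)). -/

import Mathlib

section Green

variable {T : Type*} [Semigroup T]

/-- Green's relation 𝓡. -/
def GreenR (a b : T) : Prop := a = b ∨ ∃ x y : T, a * x = b ∧ b * y = a

/-- Green's relation 𝓛. -/
def GreenL (a b : T) : Prop := a = b ∨ ∃ x y : T, x * a = b ∧ y * b = a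

/-- Green's relation 𝓓 = 𝓡 ∘ 𝓛. -/
def GreenD (a b : T) : Prop := ∃ c : T, GreenR a c ∧ GreenL c b

/-- An element is regular if `a = a * b * a` for some `b`. -/
def IsRegularElem (a : T) : Prop := ∃ b : T, a * b * a = a

/-- The principal two-sided ideal `T¹ a T¹`. -/
def principalIdeal (a : T) : Set T :=
  {x | x = a ∨ (∃ u, u * a = x) ∨ (∃ v, a * v = x) ∨ ∃ u v, u * a * v = x}

/-- Green's relation 𝓙. -/
def GreenJ (a b : T) : Prop := principalIdeal a = principalIdeal b

/-- The 𝓙-preorder. -/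
def JleRel (a b : T) : Prop := principalIdeal a ⊆ principalIdeal b

/-- Strict 𝓙-order. -/
def JltRel (a b : T) : Prop := JleRel a b ∧ ¬ JleRel b a

/-- `u` is a (two-sided) identity element. -/
def IsIdentityElem (u : T) : Prop := ∀ x : T, u * x = x ∧ x * u = x

/-- The relation 𝓡̃. -/
def RTilde (a b : T) : Prop := ∀ ε : T, ε * ε = ε → (ε * a = a ↔ ε * b = b)

/-- The relation 𝓛̃. -/
def LTilde (a b : T) : Prop := ∀ ε : T, ε * ε = ε → (a * ε = a ↔ b * ε = b)

/-- `blockProd p i k = p i * p (i+1) * ⋯ * p (i+k)`. -/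
def blockProd (p : ℕ → T) (i : ℕ) : ℕ → T
  | 0 => p i
  | k + 1 => blockProd p i k * p (i + (k + 1))

/-- Multiply `x` by optional (possibly empty) words on both sides. -/
def withCtx (u : Option T) (x : T) (v : Option T) : T :=
  match u, v with
  | none, none => x
  | some u', none => u' * x
  | none, some v' => x * v'
  | some u', some v' => u' * x * v'

/-- Multiply by an optional word on the left. -/
def leftCtx (u : Option T) (x : T) : T := match u with | none => x | some u' => u' * x

/-- Multiply by an optional word on the right. -/
def rightCtx (x : T) (v : Option T) : T := match v with | none => x | some v' => x * v'

end Green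

section IGdef

/-- The set of idempotents of `S`. -/
abbrev IdemE (S : Type*) [Semigroup S] : Type _ := {x : S // x * x = x}

variable {S : Type*} [Semigroup S]

/-- `e, f` form a basic pair if `{e,f} ∩ {ef,fe} ≠ ∅`. -/
def BasicPair (e f : IdemE S) : Prop :=
  (e : S) * f = e ∨ (e : S) * f = f ∨ (f : S) * e = e ∨ (f : S) * e = f

/-- The defining relations of IG(E): `ef = g` whenever `e, f` is a basic pair with
product `g` in `S`. -/
def igRelBase (u v : FreeSemigroup (IdemE S)) : Prop :=
  ∃ e f g : IdemE S, BasicPair e f ∧ (g : S) = (e : S) * (f : S) ∧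
    u = FreeSemigroup.of e * FreeSemigroup.of f ∧ v = FreeSemigroup.of g

/-- The congruence on the free semigroup `E⁺` generated by the defining relations. -/
def igCon (S : Type*) [Semigroup S] : Con (FreeSemigroup (IdemE S)) :=
  conGen (fun u v => igRelBase u v)

/-- The free idempotent generated semigroup IG(E). -/
abbrev IG (S : Type*) [Semigroup S] := (igCon S).Quotient

/-- `w̄`, the image of a word `w ∈ E⁺` in IG(E). -/
def igBar (w : FreeSemigroup (IdemE S)) : IG S := (w : (igCon S).Quotient)

/-- The list of letters of a word. -/
def wordList (w : FreeSemigroup (IdemE S)) : List (IdemE S) := w.head :: w.tail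

/-- The length of a word. -/
def wlen (w : FreeSemigroup (IdemE S)) : ℕ := (wordList w).length

/-- Length of an optional word. -/
def olen (u : Option (FreeSemigroup (IdemE S))) : ℕ :=
  match u with | none => 0 | some u' => wlen u'

/-- `p 1, …, p m` is an r-factorisation of `w`: each factor represents a regular
element of IG(E). -/
def IsRFact (w : FreeSemigroup (IdemE S)) (m : ℕ) (p : ℕ → FreeSemigroup (IdemE S)) : Prop :=
  1 ≤ m ∧ blockProd p 1 (m - 1) = w ∧ ∀ i, 1 ≤ i → i ≤ m → IsRegularElem (igBar (p i))

/-- A minimal r-factorisation: no product of two or more consecutive factors is regular. -/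
def IsMinRFact (w : FreeSemigroup (IdemE S)) (m : ℕ) (p : ℕ → FreeSemigroup (IdemE S)) : Prop :=
  IsRFact w m p ∧
    ∀ i j, 1 ≤ i → i < j → j ≤ m → ¬ IsRegularElem (igBar (blockProd p i (j - i)))

/-- The relation ≈ on m-tuples of words. -/
def TupleApprox (m : ℕ) (p q : ℕ → FreeSemigroup (IdemE S)) : Prop :=
  (∃ i, 1 ≤ i ∧ i ≤ m ∧ igBar (p i) = igBar (q i) ∧
    ∀ j, 1 ≤ j → j ≤ m → j ≠ i → p j = q j) ∨
  (∃ i, ∃ e : IdemE S, 1 ≤ i ∧ i < m ∧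
    igBar (p i) = igBar (q i * FreeSemigroup.of e) ∧
    igBar (q (i + 1)) = igBar (FreeSemigroup.of e * p (i + 1)) ∧
    ∀ j, 1 ≤ j → j ≤ m → j ≠ i → j ≠ i + 1 → p j = q j) ∨
  (∃ i, ∃ e : IdemE S, 1 ≤ i ∧ i < m ∧
    igBar (q i) = igBar (p i * FreeSemigroup.of e) ∧
    igBar (p (i + 1)) = igBar (FreeSemigroup.of e * q (i + 1)) ∧
    ∀ j, 1 ≤ j → j ≤ m → j ≠ i → j ≠ i + 1 → p j = q j)

/-- The relation ∼: the transitive closure of ≈. -/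
def TupleSim (m : ℕ) (p q : ℕ → FreeSemigroup (IdemE S)) : Prop :=
  Relation.TransGen (TupleApprox m) p q

/-- One application of a defining relation of IG(E) inside a word. -/
def RewriteStep (w w' : FreeSemigroup (IdemE S)) : Prop :=
  ∃ (u v : Option (FreeSemigroup (IdemE S))) (x y : FreeSemigroup (IdemE S)),
    (igRelBase x y ∨ igRelBase y x) ∧ w = withCtx u x v ∧ w' = withCtx u y v

/-- `e` is a seed of `w` at (1-based) position `k`. -/
def SeedAt (w : FreeSemigroup (IdemE S)) (e : IdemE S) (k : ℕ) : Prop :=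
  ∃ u v : Option (FreeSemigroup (IdemE S)),
    w = withCtx u (FreeSemigroup.of e) v ∧ k = olen u + 1 ∧
    GreenL (igBar (leftCtx u (FreeSemigroup.of e))) (igBar (FreeSemigroup.of e)) ∧
    GreenR (igBar (FreeSemigroup.of e)) (igBar (rightCtx (FreeSemigroup.of e) v))

/-- The coordinate (position within `w` of the first letter) of the `i`-th factor. -/
def wcoord (p : ℕ → FreeSemigroup (IdemE S)) (i : ℕ) : ℕ :=
  1 + ∑ j ∈ Finset.Ico 1 i, wlen (p j)

end IGdef

section MonoidGreen

variable {M : Type*} [Monoid M] {a b c : M}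

/-- Green's relation 𝓡 on a monoid. -/
def RightAssoc (a b : M) : Prop := ∃ x y : M, a * x = b ∧ b * y = a

/-- Green's relation 𝓛 on a monoid. -/
def LeftAssoc (a b : M) : Prop := ∃ x y : M, x * a = b ∧ y * b = a

theorem RightAssoc.refl (a : M) : RightAssoc a a := ⟨1, 1, by simp, by simp⟩

theorem RightAssoc.symm (h : RightAssoc a b) : RightAssoc b a :=
  let ⟨x, y, hx, hy⟩ := h
  ⟨y, x, hy, hx⟩

theorem RightAssoc.trans (h : RightAssoc a b) (h' : RightAssoc b c) : RightAssoc a c := by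
  obtain ⟨x, y, rfl, hy⟩ := h
  obtain ⟨z, w, rfl, hw⟩ := h'
  exact ⟨x * z, w * y, by simp [mul_assoc], by rw [← mul_assoc, hw, hy]⟩

theorem RightAssoc.mul_left (c : M) (h : RightAssoc a b) : RightAssoc (c * a) (c * b) := by
  obtain ⟨x, y, rfl, hy⟩ := h
  exact ⟨x, y, by simp [mul_assoc], by rw [mul_assoc, hy]⟩

theorem LeftAssoc.refl (a : M) : LeftAssoc a a := ⟨1, 1, by simp, by simp⟩

theorem LeftAssoc.symm (h : LeftAssoc a b) : LeftAssoc b a :=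
  let ⟨x, y, hx, hy⟩ := h
  ⟨y, x, hy, hx⟩

theorem LeftAssoc.trans (h : LeftAssoc a b) (h' : LeftAssoc b c) : LeftAssoc a c := by
  obtain ⟨x, y, rfl, hy⟩ := h
  obtain ⟨z, w, rfl, hw⟩ := h'
  exact ⟨z * x, y * w, by simp [mul_assoc], by rw [mul_assoc, hw, hy]⟩

theorem LeftAssoc.mul_right (c : M) (h : LeftAssoc a b) : LeftAssoc (a * c) (b * c) := by
  obtain ⟨x, y, rfl, hy⟩ := h
  exact ⟨x, y, by simp [mul_assoc], by rw [← mul_assoc, hy]⟩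

/-- If `a 𝓡 a * b * c` then `a 𝓡 a * b`. -/
theorem RightAssoc.of_mul (h : RightAssoc a (a * b * c)) : RightAssoc a (a * b) := by
  obtain ⟨_, y, -, hy⟩ := h
  exact ⟨b, c * y, rfl, by rw [← mul_assoc, hy]⟩

/-- If `a 𝓛 c * (b * a)` then `a 𝓛 b * a`. -/
theorem LeftAssoc.of_mul (h : LeftAssoc a (c * (b * a))) : LeftAssoc a (b * a) := by
  obtain ⟨_, y, -, hy⟩ := h
  exact ⟨b, y * c, rfl, by rw [mul_assoc, hy]⟩

theorem RightAssoc.mul_of_leftAssoc {u : M} (hu : LeftAssoc a (u * a))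
    (h : RightAssoc (u * a * b) (u * a * b * c)) : RightAssoc (a * b) (a * b * c) := by
  obtain ⟨_, x, -, hx⟩ := hu
  obtain ⟨_, y, -, hy⟩ := h
  refine ⟨c, y, rfl, ?_⟩
  calc a * b * c * y = x * (u * a * b * c * y) := by
        conv_lhs => rw [← hx]
        simp only [mul_assoc]
    _ = a * b := by rw [hy, ← mul_assoc, hx]

theorem LeftAssoc.mul_of_rightAssoc {u : M} (hu : RightAssoc a (a * u))
    (h : LeftAssoc (b * (a * u)) (c * (b * (a * u)))) : LeftAssoc (b * a) (c * (b * a)) := by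
  obtain ⟨_, x, -, hx⟩ := hu
  obtain ⟨_, y, -, hy⟩ := h
  refine ⟨c, y, rfl, ?_⟩
  calc y * (c * (b * a)) = y * (c * (b * (a * u))) * x := by
        conv_lhs => rw [← hx]
        simp only [mul_assoc]
    _ = b * a := by rw [hy, mul_assoc, hx]

theorem RightAssoc.mul_eq_iff (h : RightAssoc a b) (c : M) : c * a = a ↔ c * b = b := by
  obtain ⟨x, y, rfl, hy⟩ := h
  constructor
  · intro h
    rw [← mul_assoc, h]
  · intro h
    rw [← hy, ← mul_assoc, h]

theorem RightAssoc.idem_mul_eq_iff {e f : M} (h : RightAssoc e f) (he : e * e = e)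
    (hf : f * f = f) (a : M) : e * a = a ↔ f * a = a := by
  have h₁ : e * f = f := (h.mul_eq_iff e).1 he
  have h₂ : f * e = e := (h.mul_eq_iff f).2 hf
  constructor
  · intro h
    rw [← h, ← mul_assoc, h₂]
  · intro h
    rw [← h, ← mul_assoc, h₁]

theorem sandwich_of_rightAssoc {e x y : M} (he : e * e = e)
    (hs : x * (e * y) * (x * (e * y)) = x * (e * y))
    (h : RightAssoc e (e * (y * (x * (e * y))))) : e * y * (x * e) = e := by
  obtain ⟨_, z, -, hz⟩ := h
  set t := e * y * (x * e) with ht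
  have h₁ : t * y * z = e := by
    rw [← hz, ht]
    simp only [mul_assoc]
  have h₂ : t * e = t := by simp only [ht, mul_assoc, he]
  have h₃ : t * (t * y) = t * y := by
    calc t * (t * y) = e * y * (x * (e * e * y) * (x * (e * y))) := by simp only [ht, mul_assoc]
      _ = t * y := by rw [he, hs]; simp only [ht, mul_assoc]
  rw [← h₂, ← h₁, ← mul_assoc t, h₃]

theorem sandwich_of_leftAssoc {e x y : M} (he : e * e = e)
    (hs : x * (e * y) * (x * (e * y)) = x * (e * y))
    (h : LeftAssoc e (x * (e * (y * (x * e))))) : e * y * (x * e) = e := by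
  obtain ⟨_, z, -, hz⟩ := h
  set t := e * y * (x * e) with ht
  have h₁ : z * (x * t) = e := by
    rw [← hz, ht]
    simp only [mul_assoc]
  have h₂ : e * t = t := by simp only [ht, ← mul_assoc, he]
  have h₃ : x * t * t = x * t := by
    calc x * t * t = x * (e * y) * (x * (e * e * y)) * (x * e) := by simp only [ht, mul_assoc]
      _ = x * t := by rw [he, hs]; simp only [ht, mul_assoc]
  rw [← h₂, ← h₁, mul_assoc, h₃]

end MonoidGreen

section Presentation

variable {E M : Type*} [Monoid M]

/-- The value in `M` of a word in the alphabet `E`. -/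
def wordVal (ι : E → M) (l : List E) : M := (l.map ι).prod

/-- Replacement, inside a word, of a left hand side `ef` by the right hand side `g`. -/
def LetterStep (B : E → E → E → Prop) (l l' : List E) : Prop :=
  ∃ u v e f g, B e f g ∧ l = u ++ [e, f] ++ v ∧ l' = u ++ [g] ++ v

/-- `M` is presented by the idempotent generators `ι e` and the relations `ef = g` for `B e f g`,
and these relations and the one-letter actions behave as for basic pairs. -/
structure IdemPresentation (ι : E → M) (B : E → E → E → Prop) : Prop where
  idem : ∀ e, ι e * ι e = ι e
  rel : ∀ {e f g}, B e f g → ι e * ι f = ι g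
  assoc : ∀ {e f g}, B e f g → RightAssoc (ι e) (ι g) ∨ LeftAssoc (ι f) (ι g)
  complete : ∀ l l', wordVal ι l = wordVal ι l' → Relation.EqvGen (LetterStep B) l l'
  surj : ∀ a : M, ∃ l, wordVal ι l = a
  left_letter : ∀ x e, LeftAssoc (ι e) (ι x * ι e) → ∃ g, RightAssoc (ι x * ι e) (ι g)
  right_letter : ∀ x e, RightAssoc (ι e) (ι e * ι x) → ∃ g, LeftAssoc (ι e * ι x) (ι g)

variable {ι : E → M} {B : E → E → E → Prop}

@[simp] theorem wordVal_nil : wordVal ι [] = 1 := rfl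

@[simp] theorem wordVal_append (l l' : List E) :
    wordVal ι (l ++ l') = wordVal ι l * wordVal ι l' := by
  simp [wordVal]

@[simp] theorem wordVal_cons (e : E) (l : List E) :
    wordVal ι (e :: l) = ι e * wordVal ι l := by
  simp [wordVal]

theorem append_cons_eq_append {u v q m : List E} {g : E} (h : u ++ g :: v = q ++ m) :
    (∃ c, q = u ++ g :: c ∧ v = c ++ m) ∨ ∃ c, u = q ++ c ∧ m = c ++ g :: v := by
  rw [List.append_eq_append_iff] at h
  rcases h with ⟨_ | ⟨g', c⟩, rfl, hc⟩ | ⟨c, rfl, rfl⟩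
  · exact Or.inr ⟨[], by simp, by simpa using hc.symm⟩
  · simp only [List.cons_append, List.cons.injEq] at hc
    obtain ⟨rfl, rfl⟩ := hc
    exact Or.inl ⟨c, rfl, rfl⟩
  · exact Or.inr ⟨c, rfl, rfl⟩

theorem exists_of_append_cons_eq_power {s X Y : List E} {e : E} {n : ℕ}
    (h : X ++ e :: Y = (List.replicate n s).flatten) :
    ∃ i j s₁ s₂, s = s₁ ++ e :: s₂ ∧ X = (List.replicate i s).flatten ++ s₁ ∧
      Y = s₂ ++ (List.replicate j s).flatten := by
  induction n generalizing X with
  | zero => simp at h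
  | succ n ih =>
    rw [List.replicate_succ, List.flatten_cons] at h
    rcases append_cons_eq_append h with ⟨c, rfl, rfl⟩ | ⟨c, rfl, hc⟩
    · exact ⟨0, n, X, c, rfl, by simp, rfl⟩
    · obtain ⟨i, j, s₁, s₂, hs, rfl, hY⟩ := ih hc.symm
      exact ⟨i + 1, j, s₁, s₂, hs, by simp [List.replicate_succ], hY⟩

variable (ι) in
/-- A word is seeded if one of its letters `e` satisfies `u * e 𝓛 e 𝓡 e * v` where `u` and `v`
are the parts of the word before and after this letter. -/
def Seeded (l : List E) : Prop :=
  ∃ u e v, l = u ++ e :: v ∧ LeftAssoc (ι e) (wordVal ι u * ι e) ∧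
    RightAssoc (ι e) (ι e * wordVal ι v)

theorem seeded_singleton (e : E) : Seeded ι [e] :=
  ⟨[], e, [], rfl, by simpa using LeftAssoc.refl _, by simpa using RightAssoc.refl _⟩

theorem Seeded.ne_nil {l : List E} (h : Seeded ι l) : l ≠ [] := by
  obtain ⟨u, e, v, rfl, -⟩ := h
  simp

theorem seeded_append {a b : List E} : Seeded ι (a ++ b) ↔
    (Seeded ι a ∧ RightAssoc (wordVal ι a) (wordVal ι a * wordVal ι b)) ∨
    (Seeded ι b ∧ LeftAssoc (wordVal ι b) (wordVal ι a * wordVal ι b)) := by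
  constructor
  · rintro ⟨u, e, v, h, hl, hr⟩
    rcases append_cons_eq_append h.symm with ⟨c, rfl, rfl⟩ | ⟨c, rfl, rfl⟩
    · left
      simp only [wordVal_append, ← mul_assoc] at hr
      refine ⟨⟨u, e, c, rfl, hl, hr.of_mul⟩, ?_⟩
      have h := (hr.of_mul.symm.trans hr).mul_left (wordVal ι u)
      simpa [mul_assoc] using h
    · right
      simp only [wordVal_append, mul_assoc] at hl
      refine ⟨⟨c, e, v, rfl, hl.of_mul, hr⟩, ?_⟩
      have h := (hl.of_mul.symm.trans hl).mul_right (wordVal ι v)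
      simpa [mul_assoc] using h
  · rintro (⟨⟨u, e, v, rfl, hl, hr⟩, h⟩ | ⟨⟨u, e, v, rfl, hl, hr⟩, h⟩)
    · refine ⟨u, e, v ++ b, by simp, hl, ?_⟩
      simp only [wordVal_append, wordVal_cons, ← mul_assoc] at h ⊢
      exact hr.trans (h.mul_of_leftAssoc hl)
    · refine ⟨a ++ u, e, v, by simp, ?_, hr⟩
      simp only [wordVal_append, wordVal_cons] at h ⊢
      rw [mul_assoc]
      exact hl.trans (h.mul_of_rightAssoc hr)

variable (ι) in
/-- `l` is a product of `n + 1` seeded words, the first of which has a value 𝓡-related to `r`. -/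
def SeedFact (n : ℕ) (l : List E) (r : M) : Prop :=
  ∃ (q : List E) (qs : List (List E)), l = q ++ qs.flatten ∧ Seeded ι q ∧ (∀ p ∈ qs, Seeded ι p) ∧
    qs.length = n ∧ RightAssoc (wordVal ι q) r

variable (ι) in
/-- `SeedFact` with the least possible number of factors. -/
def MinSeedFact (n : ℕ) (l : List E) (r : M) : Prop :=
  SeedFact ι n l r ∧ ∀ k < n, ∀ r', ¬ SeedFact ι k l r'

theorem seedFact_of_append {q m : List E} {n : ℕ} {r r' : M} (hq : Seeded ι q)
    (hr : RightAssoc (wordVal ι q) r) (h : SeedFact ι n m r') : SeedFact ι (n + 1) (q ++ m) r := by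
  obtain ⟨p, ps, rfl, hp, hps, rfl, -⟩ := h
  exact ⟨q, p :: ps, by simp, hq, by simpa using ⟨hp, hps⟩, by simp, hr⟩

theorem seedFact_zero {q : List E} {r : M} (hq : Seeded ι q)
    (hr : RightAssoc (wordVal ι q) r) : SeedFact ι 0 q r :=
  ⟨q, [], by simp, hq, by simp, by simp, hr⟩

theorem SeedFact.exists_append {q m : List E} {n : ℕ} {r' : M} (hq : Seeded ι q)
    (h : SeedFact ι n m r') : ∃ r, SeedFact ι (n + 1) (q ++ m) r :=
  ⟨_, seedFact_of_append hq (RightAssoc.refl _) h⟩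

/-- Every word with `n + 1` seeded factors is a single seeded word, or a seeded word followed by
a word with `n` seeded factors. -/
theorem SeedFact.cases {l : List E} {n : ℕ} {r : M} (h : SeedFact ι n l r) :
    (n = 0 ∧ Seeded ι l ∧ RightAssoc (wordVal ι l) r) ∨
    ∃ k q m r', n = k + 1 ∧ l = q ++ m ∧ Seeded ι q ∧ RightAssoc (wordVal ι q) r ∧
      SeedFact ι k m r' := by
  obtain ⟨q, _ | ⟨p, ps⟩, rfl, hq, hqs, rfl, hr⟩ := h
  · left
    simpa using ⟨hq, hr⟩
  · right
    exact ⟨ps.length, q, p ++ ps.flatten, _, by simp, by simp, hq, hr, p, ps, rfl,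
      hqs p (by simp), fun p hp => hqs p (by simp [hp]), rfl, RightAssoc.refl _⟩

theorem exists_seedFact {l : List E} (hl : l ≠ []) : ∃ n r, SeedFact ι n l r := by
  induction l with
  | nil => exact absurd rfl hl
  | cons e t ih =>
    rcases eq_or_ne t [] with rfl | ht
    · exact ⟨0, _, seedFact_zero (seeded_singleton e) (RightAssoc.refl _)⟩
    · obtain ⟨n, r, h⟩ := ih ht
      obtain ⟨r', h'⟩ := h.exists_append (seeded_singleton e)
      exact ⟨n + 1, r', h'⟩

theorem SeedFact.exists_min {l : List E} {n : ℕ} {r : M} (h : SeedFact ι n l r) :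
    ∃ k ≤ n, ∃ r', MinSeedFact ι k l r' := by
  classical
  have hex : ∃ n, ∃ r, SeedFact ι n l r := ⟨n, r, h⟩
  obtain ⟨r', hr'⟩ := Nat.find_spec hex
  exact ⟨Nat.find hex, Nat.find_min' hex ⟨r, h⟩, r', hr',
    fun k hk r hr => Nat.find_min hex hk ⟨r, hr⟩⟩

theorem exists_minSeedFact {l : List E} (hl : l ≠ []) : ∃ n r, MinSeedFact ι n l r := by
  obtain ⟨n, r, h⟩ := exists_seedFact (ι := ι) hl
  obtain ⟨k, -, r', h'⟩ := h.exists_min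
  exact ⟨k, r', h'⟩

namespace IdemPresentation

theorem wordVal_eq_of_step (hP : IdemPresentation ι B) {l l' : List E} (h : LetterStep B l l') :
    wordVal ι l = wordVal ι l' := by
  obtain ⟨u, v, e, f, g, hB, rfl, rfl⟩ := h
  have h : ι e * ι f = ι g := hP.rel hB
  simp [← h, mul_assoc]

theorem seeded_pair (hP : IdemPresentation ι B) {e f g : E} (hB : B e f g) : Seeded ι [e, f] := by
  rw [← List.singleton_append, seeded_append]
  have h := hP.rel hB
  rcases hP.assoc hB with h' | h'
  · exact Or.inl ⟨seeded_singleton e, by simpa [h] using h'⟩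
  · exact Or.inr ⟨seeded_singleton f, by simpa [h] using h'⟩

theorem seeded_congr_step (hP : IdemPresentation ι B) {l l' : List E} (h : LetterStep B l l') :
    Seeded ι l ↔ Seeded ι l' := by
  obtain ⟨u, v, e, f, g, hB, rfl, rfl⟩ := h
  have h := hP.rel hB
  simp only [seeded_append (b := v), seeded_append (a := u), hP.seeded_pair hB,
    seeded_singleton, wordVal_append, wordVal_cons, wordVal_nil, mul_one, h]

/-- A relation contracting the last letter of a seeded word `u ++ [e]` with the first letter of a
seeded word `f :: q` either can be absorbed into one of the two words, or joins them. -/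
theorem seeded_straddle (hP : IdemPresentation ι B)
    {u q : List E} {e f g : E} (hB : B e f g) (hu : Seeded ι (u ++ [e]))
    (hq : Seeded ι (f :: q)) :
    Seeded ι (u ++ [g] ++ q) ∨
    (Seeded ι (u ++ [g]) ∧ RightAssoc (wordVal ι (u ++ [e])) (wordVal ι (u ++ [g])) ∧
      Seeded ι q) ∨
    (Seeded ι u ∧ RightAssoc (wordVal ι (u ++ [e])) (wordVal ι u) ∧ Seeded ι (g :: q)) := by
  have hg := hP.rel hB
  have hfq := hq
  rw [← List.singleton_append, seeded_append] at hfq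
  have hue := hu
  rw [seeded_append] at hue
  simp only [wordVal_cons, wordVal_nil, mul_one, seeded_singleton, true_and] at hfq hue
  rcases hP.assoc hB with h | h
  · have hur : RightAssoc (wordVal ι (u ++ [e])) (wordVal ι (u ++ [g])) := by
      simpa using h.mul_left (wordVal ι u)
    have hug : Seeded ι (u ++ [g]) := by
      rw [seeded_append]
      simp only [wordVal_cons, wordVal_nil, mul_one, seeded_singleton, true_and]
      rcases hue with ⟨h₁, h₂⟩ | h₁
      · exact Or.inl ⟨h₁, h₂.trans (h.mul_left _)⟩
      · right
        have := h₁.mul_right (ι f)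
        rwa [mul_assoc, hg] at this
    rcases hfq with h₁ | ⟨h₁, -⟩
    · left
      rw [seeded_append]
      left
      refine ⟨hug, ?_⟩
      have := h₁.mul_left (wordVal ι u * ι e)
      simpa [← hg, mul_assoc] using this
    · exact Or.inr (Or.inl ⟨hug, hur, h₁⟩)
  · have hgq : Seeded ι (g :: q) := by
      rw [← List.singleton_append, seeded_append]
      simp only [wordVal_cons, wordVal_nil, mul_one, seeded_singleton, true_and]
      rcases hfq with h₁ | ⟨h₁, h₂⟩
      · left
        have := h₁.mul_left (ι e)
        rwa [← mul_assoc, hg] at this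
      · exact Or.inr ⟨h₁, h₂.trans (h.mul_right _)⟩
    rcases hue with ⟨h₁, h₂⟩ | h₁
    · exact Or.inr (Or.inr ⟨h₁, by simpa using h₂.symm, hgq⟩)
    · left
      rw [List.append_assoc, seeded_append]
      right
      refine ⟨hgq, ?_⟩
      have := h₁.mul_right (ι f * wordVal ι q)
      simpa [← hg, mul_assoc] using this

theorem seedFact_of_expand (hP : IdemPresentation ι B)
    {n : ℕ} {l l' : List E} {r : M} (h : LetterStep B l' l)
    (hF : SeedFact ι n l r) : SeedFact ι n l' r := by
  induction n generalizing l l' r with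
  | zero =>
    rcases hF.cases with ⟨-, hl, hr⟩ | ⟨k, _, _, _, hk, -⟩
    · refine seedFact_zero ((hP.seeded_congr_step h).2 hl) ?_
      rwa [hP.wordVal_eq_of_step h]
    · omega
  | succ n ih =>
    rcases hF.cases with ⟨hn, -⟩ | ⟨k, q, m, r', hk, rfl, hq, hr, hm⟩
    · omega
    obtain rfl : n = k := by omega
    obtain ⟨u, v, e, f, g, hB, rfl, hl⟩ := h
    rw [List.append_assoc, eq_comm, List.singleton_append] at hl
    rcases append_cons_eq_append hl with ⟨c, rfl, rfl⟩ | ⟨c, rfl, rfl⟩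
    · have hst : LetterStep B (u ++ [e, f] ++ c) (u ++ g :: c) :=
        ⟨u, c, e, f, g, hB, rfl, by simp⟩
      rw [← List.append_assoc]
      refine seedFact_of_append ((hP.seeded_congr_step hst).2 hq) ?_ hm
      rwa [hP.wordVal_eq_of_step hst]
    · have hst : LetterStep B (c ++ [e, f] ++ v) (c ++ g :: v) :=
        ⟨c, v, e, f, g, hB, rfl, by simp⟩
      simpa using seedFact_of_append hq hr (ih hst hm)

theorem seedFact_of_contract (hP : IdemPresentation ι B)
    {n : ℕ} {l l' : List E} {r : M} (h : LetterStep B l l')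
    (hF : SeedFact ι n l r) : SeedFact ι n l' r ∨ ∃ k < n, ∃ r', SeedFact ι k l' r' := by
  induction n generalizing l l' r with
  | zero =>
    rcases hF.cases with ⟨-, hl, hr⟩ | ⟨k, _, _, _, hk, -⟩
    · refine Or.inl (seedFact_zero ((hP.seeded_congr_step h).1 hl) ?_)
      rwa [← hP.wordVal_eq_of_step h]
    · omega
  | succ n ih =>
    rcases hF.cases with ⟨hn, -⟩ | ⟨k, q, m, r', hk, rfl, hq, hr, hm⟩
    · omega
    obtain rfl : n = k := by omega
    obtain ⟨u, v, e, f, g, hB, hl, rfl⟩ := h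
    rw [List.append_assoc, eq_comm, List.cons_append, List.singleton_append] at hl
    rcases append_cons_eq_append hl with ⟨_ | ⟨f', c⟩, rfl, hv⟩ | ⟨c, rfl, rfl⟩
    · rw [List.nil_append] at hv
      subst hv
      rcases hm.cases with ⟨rfl, hfv, -⟩ | ⟨k, p, m, s, rfl, hfv, hp, -, hm'⟩
      · rcases hP.seeded_straddle hB hq hfv with h | ⟨h, h', hv⟩ | ⟨h, h', hv⟩
        · exact Or.inr ⟨0, by omega, _, seedFact_zero h (RightAssoc.refl _)⟩
        · exact Or.inl (seedFact_of_append h (h'.symm.trans hr)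
            (seedFact_zero hv (RightAssoc.refl _)))
        · left
          rw [List.append_assoc]
          exact seedFact_of_append h (h'.symm.trans hr) (seedFact_zero hv (RightAssoc.refl _))
      · rcases p with _ | ⟨f', p⟩
        · exact absurd rfl hp.ne_nil
        simp only [List.cons_append, List.cons.injEq] at hfv
        obtain ⟨rfl, rfl⟩ := hfv
        rcases hP.seeded_straddle hB hq hp with h | ⟨h, h', hv⟩ | ⟨h, h', hv⟩
        · refine Or.inr ⟨k + 1, by omega, wordVal ι (u ++ [g] ++ p), ?_⟩
          rw [← List.append_assoc]
          exact seedFact_of_append h (RightAssoc.refl _) hm'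
        · exact Or.inl (seedFact_of_append h (h'.symm.trans hr)
            (seedFact_of_append hv (RightAssoc.refl _) hm'))
        · left
          rw [List.append_assoc, List.singleton_append, ← List.cons_append]
          exact seedFact_of_append h (h'.symm.trans hr)
            (seedFact_of_append hv (RightAssoc.refl _) hm')
    · simp only [List.cons_append, List.cons.injEq] at hv
      obtain ⟨rfl, rfl⟩ := hv
      have hst : LetterStep B (u ++ e :: f :: c) (u ++ [g] ++ c) :=
        ⟨u, c, e, f, g, hB, by simp, rfl⟩
      left
      rw [← List.append_assoc]
      refine seedFact_of_append ((hP.seeded_congr_step hst).1 hq) ?_ hm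
      rwa [← hP.wordVal_eq_of_step hst]
    · have hst : LetterStep B (c ++ e :: f :: v) (c ++ [g] ++ v) :=
        ⟨c, v, e, f, g, hB, by simp, rfl⟩
      rcases ih hst hm with h | ⟨k, hk, s, h⟩
      · left
        simpa using seedFact_of_append hq hr h
      · obtain ⟨s', h⟩ := h.exists_append hq
        exact Or.inr ⟨k + 1, by omega, s', by simpa using h⟩

theorem minSeedFact_congr (hP : IdemPresentation ι B)
    {n : ℕ} {l l' : List E} {r : M} (h : wordVal ι l = wordVal ι l') :
    MinSeedFact ι n l r ↔ MinSeedFact ι n l' r := by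
  have hs := hP.complete l l' h
  clear h
  induction hs with
  | rel l l' h =>
    constructor
    · rintro ⟨hF, hmin⟩
      refine ⟨?_, fun k hk s hs => hmin k hk s (hP.seedFact_of_expand h hs)⟩
      rcases hP.seedFact_of_contract h hF with h' | ⟨k, hk, s, hs⟩
      · exact h'
      · exact absurd (hP.seedFact_of_expand h hs) (hmin k hk s)
    · rintro ⟨hF, hmin⟩
      refine ⟨hP.seedFact_of_expand h hF, fun k hk s hs => ?_⟩
      rcases hP.seedFact_of_contract h hs with h' | ⟨j, hj, s, hs⟩
      · exact hmin k hk s h'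
      · exact hmin j (by omega) s hs
  | refl => rfl
  | symm l l' _ ih => exact ih.symm
  | trans l l' l'' _ _ ih ih' => exact ih.trans ih'

theorem exists_letter_of_leftAssoc (hP : IdemPresentation ι B) (u : List E) (e : E)
    (h : LeftAssoc (ι e) (wordVal ι u * ι e)) :
    ∃ j, RightAssoc (wordVal ι u * ι e) (ι j) := by
  induction u using List.reverseRecOn generalizing e with
  | nil => exact ⟨e, by simpa using RightAssoc.refl _⟩
  | append_singleton u x ih =>
    simp only [wordVal_append, wordVal_cons, wordVal_nil, mul_one, mul_assoc] at h ⊢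
    obtain ⟨g, hg⟩ := hP.left_letter x e h.of_mul
    obtain ⟨z, -, hz, -⟩ := id hg
    have hug := (h.of_mul.symm.trans h).mul_right z
    rw [hz, mul_assoc, hz] at hug
    obtain ⟨j, hj⟩ := ih g hug
    exact ⟨j, (hg.mul_left _).trans hj⟩

/-- The value of a seeded word is 𝓡-related to a generator. -/
theorem exists_letter_of_seeded (hP : IdemPresentation ι B) {l : List E} (h : Seeded ι l) :
    ∃ j, RightAssoc (wordVal ι l) (ι j) := by
  obtain ⟨u, e, v, rfl, hl, hr⟩ := h
  obtain ⟨j, hj⟩ := hP.exists_letter_of_leftAssoc u e hl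
  refine ⟨j, ?_⟩
  rw [wordVal_append, wordVal_cons]
  exact (hr.mul_left _).symm.trans hj

theorem seeded_of_infix_power (hP : IdemPresentation ι B) {s c r d : List E} {n : ℕ}
    (hs : wordVal ι s * wordVal ι s = wordVal ι s)
    (h : c ++ r ++ d = (List.replicate n s).flatten) (hr : Seeded ι r)
    (hlen : 2 * s.length < r.length) : Seeded ι s := by
  obtain ⟨x, e, y, rfl, hx, hy⟩ := hr
  obtain ⟨i, j, s₁, s₂, rfl, hX, hY⟩ :=
    exists_of_append_cons_eq_power (X := c ++ x) (Y := y ++ d) (by simpa using h)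
  simp only [wordVal_append, wordVal_cons] at hs
  have left : ∀ t, t.length ≤ x.length → t <:+ c ++ x →
      LeftAssoc (ι e) (wordVal ι t * ι e) := by
    intro t ht htx
    obtain ⟨x', rfl⟩ := List.suffix_of_suffix_length_le htx (List.suffix_append c x) ht
    simp only [wordVal_append, mul_assoc] at hx
    exact hx.of_mul
  have right : ∀ t, t.length ≤ y.length → t <+: y ++ d →
      RightAssoc (ι e) (ι e * wordVal ι t) := by
    intro t ht hty
    obtain ⟨y', rfl⟩ := List.prefix_of_prefix_length_le hty (List.prefix_append y d) ht
    simp only [wordVal_append, ← mul_assoc] at hy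
    exact hy.of_mul
  have seeded : ι e * wordVal ι s₂ * (wordVal ι s₁ * ι e) = ι e → Seeded ι (s₁ ++ e :: s₂) :=
    fun h => ⟨s₁, e, s₂, rfl, ⟨_, _, rfl, h⟩, ⟨_, _, rfl, h⟩⟩
  by_cases h₁ : s₁.length + (s₁ ++ e :: s₂).length ≤ x.length
  · rcases i with _ | i
    · have := congrArg List.length hX
      simp at this h₁
      omega
    · apply seeded
      have h := left (s₁ ++ e :: s₂ ++ s₁) (by simp at h₁ ⊢; omega)
        ⟨(List.replicate i (s₁ ++ e :: s₂)).flatten, by rw [hX, List.replicate_succ']; simp⟩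
      apply sandwich_of_leftAssoc (hP.idem e) hs
      simpa [mul_assoc] using h
  by_cases h₂ : s₂.length + (s₁ ++ e :: s₂).length ≤ y.length
  · rcases j with _ | j
    · have := congrArg List.length hY
      simp at this h₂
      omega
    · apply seeded
      have h := right (s₂ ++ (s₁ ++ e :: s₂)) (by simp at h₂ ⊢; omega)
        ⟨(List.replicate j (s₁ ++ e :: s₂)).flatten, by rw [hY, List.replicate_succ]; simp⟩
      apply sandwich_of_rightAssoc (hP.idem e) hs
      simpa [mul_assoc] using h
  simp at h₁ h₂ hlen
  exact ⟨s₁, e, s₂, rfl, left s₁ (by omega) ⟨_, hX.symm⟩, right s₂ (by omega) ⟨_, hY.symm⟩⟩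

theorem seeded_of_idem (hP : IdemPresentation ι B) {s : List E} (hne : s ≠ [])
    (hs : wordVal ι s * wordVal ι s = wordVal ι s) : Seeded ι s := by
  obtain ⟨n, r, hF⟩ := exists_minSeedFact (ι := ι) hne
  have hpow : ∀ k, wordVal ι (List.replicate (k + 1) s).flatten = wordVal ι s := by
    intro k
    induction k with
    | zero => simp
    | succ k ih => rw [List.replicate_succ, List.flatten_cons, wordVal_append, ih, hs]
  obtain ⟨⟨q, qs, hq, hsq, hsqs, rfl, -⟩, -⟩ :=
    (hP.minSeedFact_congr (hpow (2 * n + 2)).symm).1 hF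
  by_contra hns
  have hmem : ∀ p ∈ q :: qs, p.length ≤ 2 * s.length := by
    intro p hp
    by_contra! hlen
    obtain ⟨as, bs, hab⟩ := List.append_of_mem hp
    have hsp : Seeded ι p := by
      rcases List.mem_cons.1 hp with rfl | hp
      · exact hsq
      · exact hsqs p hp
    refine hns (hP.seeded_of_infix_power (c := as.flatten) (d := bs.flatten)
      (n := 2 * qs.length + 2 + 1) hs ?_ hsp hlen)
    have h := congrArg List.flatten hab
    rw [List.flatten_cons, ← hq] at h
    simp [h]
  have hsum := List.sum_le_card_nsmul ((q :: qs).map List.length) (2 * s.length)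
    (by simpa using hmem)
  have hlen := congrArg List.length hq
  rw [← List.flatten_cons, List.length_flatten, List.length_flatten] at hlen
  simp only [List.map_replicate, List.sum_replicate, smul_eq_mul] at hlen
  simp only [← hlen, List.length_map, List.length_cons, smul_eq_mul] at hsum
  have := List.length_pos_iff.2 hne
  nlinarith

theorem exists_letter_of_idem (hP : IdemPresentation ι B) {ε : M} (hε : ε * ε = ε) :
    ε = 1 ∨ ∃ j, RightAssoc ε (ι j) := by
  obtain ⟨s, rfl⟩ := hP.surj ε
  rcases eq_or_ne s [] with rfl | hne
  · exact Or.inl rfl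
  · exact Or.inr (hP.exists_letter_of_seeded (hP.seeded_of_idem hne hε))

theorem exists_letter_of_minSeedFact (hP : IdemPresentation ι B)
    {n : ℕ} {l : List E} {r : M} (h : MinSeedFact ι n l r) :
    ∃ j, RightAssoc r (ι j) := by
  obtain ⟨⟨q, qs, -, hq, -, -, hr⟩, -⟩ := h
  obtain ⟨j, hj⟩ := hP.exists_letter_of_seeded hq
  exact ⟨j, hr.symm.trans hj⟩

/-- The idempotent left identities of a word are those of the first factor of a minimal
factorisation into seeded words. -/
theorem mul_eq_iff_of_minSeedFact (hP : IdemPresentation ι B)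
    {n : ℕ} {l : List E} {r ε : M} (h : MinSeedFact ι n l r)
    (hε : ε * ε = ε) : ε * wordVal ι l = wordVal ι l ↔ ε * r = r := by
  constructor
  · intro hl
    rcases hP.exists_letter_of_idem hε with rfl | ⟨j, hj⟩
    · simp
    rw [hj.idem_mul_eq_iff hε (hP.idem j)] at hl ⊢
    rw [← wordVal_cons] at hl
    obtain ⟨⟨q, qs, hq, hsq, -, -, hr⟩, -⟩ := (hP.minSeedFact_congr hl).2 h
    rcases q with _ | ⟨j', q⟩
    · exact absurd rfl hsq.ne_nil
    simp only [List.cons_append, List.cons.injEq] at hq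
    obtain ⟨rfl, -⟩ := hq
    rw [← hr.mul_eq_iff, wordVal_cons, ← mul_assoc, hP.idem]
  · intro hl
    obtain ⟨⟨q, qs, rfl, -, -, -, hr⟩, -⟩ := h
    rw [wordVal_append, ← mul_assoc, (hr.mul_eq_iff ε).2 hl]

theorem rightAssoc_of_idem_iff (hP : IdemPresentation ι B)
    {r r' : M} {i j : E} (hi : RightAssoc r (ι i))
    (hj : RightAssoc r' (ι j)) (h : ∀ ε : M, ε * ε = ε → (ε * r = r ↔ ε * r' = r')) :
    RightAssoc r r' := by
  have h₁ : ι i * ι j = ι j := by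
    rw [← hj.mul_eq_iff, ← h _ (hP.idem i), hi.mul_eq_iff, hP.idem]
  have h₂ : ι j * ι i = ι i := by
    rw [← hi.mul_eq_iff, h _ (hP.idem j), hj.mul_eq_iff, hP.idem]
  exact hi.trans (RightAssoc.trans ⟨_, _, h₁, h₂⟩ hj.symm)

theorem letter_mul_eq_iff_of_minSeedFact (hP : IdemPresentation ι B) {n : ℕ} {l : List E} {r ε : M}
    (h : MinSeedFact ι n l r) (f : E) (hε : ε * ε = ε) :
    ε * (ι f * wordVal ι l) = ι f * wordVal ι l ↔ ε * (ι f * r) = ι f * r := by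
  constructor
  · rw [← wordVal_cons]
    intro hl
    have of_letter : ε * ι f = ι f → ε * (ι f * r) = ι f * r := fun h => by
      rw [← mul_assoc, h]
    obtain ⟨r₀, hr₀⟩ := h.1.exists_append (seeded_singleton f)
    have hf : SeedFact ι (n + 1) (f :: l) (ι f) :=
      seedFact_of_append (seeded_singleton f) (by simpa using RightAssoc.refl _) h.1
    obtain ⟨k, hk, r₁, hr₁⟩ := hf.exists_min
    rcases hk.eq_or_lt with rfl | hk
    · exact of_letter ((hP.mul_eq_iff_of_minSeedFact ⟨hf, hr₁.2⟩ hε).1 hl)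
    have hl' := (hP.mul_eq_iff_of_minSeedFact hr₁ hε).1 hl
    obtain ⟨⟨q, qs, hq, hsq, hqs, hlen, hr⟩, -⟩ := hr₁
    rcases q with _ | ⟨f', q⟩
    · exact absurd rfl hsq.ne_nil
    simp only [List.cons_append, List.cons.injEq] at hq
    obtain ⟨rfl, rfl⟩ := hq
    rw [← hr.mul_eq_iff] at hl'
    rw [← List.singleton_append, seeded_append] at hsq
    simp only [wordVal_cons, wordVal_nil, mul_one] at hsq hl'
    rcases hsq with ⟨-, hsq⟩ | ⟨hsq, -⟩
    · exact of_letter ((hsq.mul_eq_iff ε).2 hl')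
    · have hF : SeedFact ι k (q ++ qs.flatten) (wordVal ι q) :=
        ⟨q, qs, rfl, hsq, hqs, hlen, RightAssoc.refl _⟩
      obtain rfl : k = n := by
        by_contra hne
        exact h.2 k (by omega) _ hF
      have hF' : MinSeedFact ι k (q ++ qs.flatten) (wordVal ι q) := ⟨hF, h.2⟩
      obtain ⟨i, hi⟩ := hP.exists_letter_of_minSeedFact h
      obtain ⟨j, hj⟩ := hP.exists_letter_of_minSeedFact hF'
      have hrq := hP.rightAssoc_of_idem_iff hi hj fun ε hε => by
        rw [← hP.mul_eq_iff_of_minSeedFact h hε, hP.mul_eq_iff_of_minSeedFact hF' hε]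
      exact ((hrq.mul_left _).mul_eq_iff ε).2 hl'
  · intro hl
    obtain ⟨⟨q, qs, rfl, -, -, -, hr⟩, -⟩ := h
    rw [← (hr.mul_left _).mul_eq_iff] at hl
    rw [wordVal_append, ← mul_assoc (ι f), ← mul_assoc, hl]

theorem rTilde_letter_mul (hP : IdemPresentation ι B) {l l' : List E} (hl : l ≠ []) (hl' : l' ≠ [])
    (h : RTilde (wordVal ι l) (wordVal ι l')) (f : E) :
    RTilde (ι f * wordVal ι l) (ι f * wordVal ι l') := by
  obtain ⟨n, r, hr⟩ := exists_minSeedFact (ι := ι) hl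
  obtain ⟨n', r', hr'⟩ := exists_minSeedFact (ι := ι) hl'
  obtain ⟨i, hi⟩ := hP.exists_letter_of_minSeedFact hr
  obtain ⟨j, hj⟩ := hP.exists_letter_of_minSeedFact hr'
  have hrr := hP.rightAssoc_of_idem_iff hi hj fun ε hε => by
    rw [← hP.mul_eq_iff_of_minSeedFact hr hε, h ε hε, hP.mul_eq_iff_of_minSeedFact hr' hε]
  intro ε hε
  rw [hP.letter_mul_eq_iff_of_minSeedFact hr f hε, (hrr.mul_left _).mul_eq_iff,
    hP.letter_mul_eq_iff_of_minSeedFact hr' f hε]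

theorem rTilde_mul_left (hP : IdemPresentation ι B) {l l' : List E} (hl : l ≠ []) (hl' : l' ≠ [])
    (h : RTilde (wordVal ι l) (wordVal ι l')) (c : M) :
    RTilde (c * wordVal ι l) (c * wordVal ι l') := by
  obtain ⟨w, rfl⟩ := hP.surj c
  induction w with
  | nil => simpa using h
  | cons f w ih =>
    rw [wordVal_cons, mul_assoc, mul_assoc, ← wordVal_append, ← wordVal_append] at *
    exact hP.rTilde_letter_mul (by simp [hl]) (by simp [hl']) ih f

end IdemPresentation

theorem wordVal_op (l : List E) :
    wordVal (fun e => MulOpposite.op (ι e)) l = MulOpposite.op (wordVal ι l.reverse) := by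
  induction l with
  | nil => rfl
  | cons e l ih => simp [ih]

theorem RightAssoc.op {a b : M} (h : RightAssoc a b) :
    LeftAssoc (MulOpposite.op a) (MulOpposite.op b) := by
  obtain ⟨x, y, rfl, hy⟩ := h
  exact ⟨MulOpposite.op x, MulOpposite.op y, rfl, congrArg MulOpposite.op hy⟩

theorem LeftAssoc.op {a b : M} (h : LeftAssoc a b) :
    RightAssoc (MulOpposite.op a) (MulOpposite.op b) := by
  obtain ⟨x, y, rfl, hy⟩ := h
  exact ⟨MulOpposite.op x, MulOpposite.op y, rfl, congrArg MulOpposite.op hy⟩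

theorem RightAssoc.unop {a b : Mᵐᵒᵖ} (h : RightAssoc a b) : LeftAssoc a.unop b.unop := by
  obtain ⟨x, y, rfl, hy⟩ := h
  exact ⟨x.unop, y.unop, rfl, congrArg MulOpposite.unop hy⟩

theorem LeftAssoc.unop {a b : Mᵐᵒᵖ} (h : LeftAssoc a b) : RightAssoc a.unop b.unop := by
  obtain ⟨x, y, rfl, hy⟩ := h
  exact ⟨x.unop, y.unop, rfl, congrArg MulOpposite.unop hy⟩

theorem eqvGen_letterStep_reverse {l l' : List E} (h : Relation.EqvGen (LetterStep B) l l') :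
    Relation.EqvGen (LetterStep fun e f g => B f e g) l.reverse l'.reverse := by
  induction h with
  | rel l l' h =>
    obtain ⟨u, v, e, f, g, hB, rfl, rfl⟩ := h
    exact .rel _ _ ⟨v.reverse, u.reverse, f, e, g, hB, by simp, by simp⟩
  | refl => exact .refl _
  | symm _ _ _ ih => exact ih.symm
  | trans _ _ _ _ _ ih ih' => exact ih.trans _ _ _ ih'

theorem IdemPresentation.op (hP : IdemPresentation ι B) :
    IdemPresentation (fun e => MulOpposite.op (ι e)) (fun e f g => B f e g) where
  idem e := congrArg MulOpposite.op (hP.idem e)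
  rel h := congrArg MulOpposite.op (hP.rel h)
  assoc h := (hP.assoc h).symm.imp LeftAssoc.op RightAssoc.op
  complete l l' h := by
    rw [wordVal_op, wordVal_op] at h
    simpa using eqvGen_letterStep_reverse (hP.complete _ _ (MulOpposite.op_injective h))
  surj a := by
    obtain ⟨l, hl⟩ := hP.surj a.unop
    exact ⟨l.reverse, by simp [wordVal_op, hl]⟩
  left_letter x e h := by
    obtain ⟨g, hg⟩ := hP.right_letter x e h.unop
    exact ⟨g, hg.op⟩
  right_letter x e h := by
    obtain ⟨g, hg⟩ := hP.left_letter x e h.unop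
    exact ⟨g, hg.op⟩

theorem lTilde_iff_rTilde_op {T : Type*} [Semigroup T] {a b : T} :
    LTilde a b ↔ RTilde (MulOpposite.op a) (MulOpposite.op b) := by
  constructor
  · intro h ε hε
    have := h ε.unop (congrArg MulOpposite.unop hε)
    rwa [← MulOpposite.op_inj, ← MulOpposite.op_inj (x := b * _)] at this
  · intro h ε hε
    have := h (MulOpposite.op ε) (congrArg MulOpposite.op hε)
    rwa [← MulOpposite.op_mul, ← MulOpposite.op_mul, MulOpposite.op_inj, MulOpposite.op_inj] at this

theorem IdemPresentation.lTilde_mul_right (hP : IdemPresentation ι B) {l l' : List E}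
    (hl : l ≠ []) (hl' : l' ≠ []) (h : LTilde (wordVal ι l) (wordVal ι l')) (c : M) :
    LTilde (wordVal ι l * c) (wordVal ι l' * c) := by
  rw [lTilde_iff_rTilde_op] at h ⊢
  have := hP.op.rTilde_mul_left (l := l.reverse) (l' := l'.reverse) (by simpa using hl)
    (by simpa using hl') (by simpa [wordVal_op] using h) (MulOpposite.op c)
  simpa [wordVal_op] using this

end Presentation

section WithOne

variable {T : Type*} [Semigroup T]

theorem rTilde_coe_iff {a b : T} : RTilde (a : WithOne T) (b : WithOne T) ↔ RTilde a b := by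
  constructor
  · intro h ε hε
    have := h ε (by rw [← WithOne.coe_mul, hε])
    simpa only [← WithOne.coe_mul, WithOne.coe_inj] using this
  · intro h ε hε
    cases ε with
    | one => simp
    | coe ε =>
      simp only [← WithOne.coe_mul, WithOne.coe_inj] at hε ⊢
      exact h ε hε

theorem lTilde_coe_iff {a b : T} : LTilde (a : WithOne T) (b : WithOne T) ↔ LTilde a b := by
  constructor
  · intro h ε hε
    have := h ε (by rw [← WithOne.coe_mul, hε])
    simpa only [← WithOne.coe_mul, WithOne.coe_inj] using this
  · intro h ε hε
    cases ε with
    | one => simp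
    | coe ε =>
      simp only [← WithOne.coe_mul, WithOne.coe_inj] at hε ⊢
      exact h ε hε

end WithOne

section IGPresentation

variable {S : Type*} [Semigroup S]

variable (S) in
/-- The generator of `IG(E)` given by an idempotent, in the monoid `IG(E)¹`. -/
def igGen (e : IdemE S) : WithOne (IG S) := (igBar (FreeSemigroup.of e) : IG S)

/-- The defining relations of `IG(E)`, as relations between letters. -/
def igRelLetter (e f g : IdemE S) : Prop := BasicPair e f ∧ (g : S) = (e : S) * (f : S)

theorem igGen_mul {e f g : IdemE S} (h : igRelLetter e f g) :
    igGen S e * igGen S f = igGen S g := by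
  have : igCon S (FreeSemigroup.of e * FreeSemigroup.of f) (FreeSemigroup.of g) :=
    ConGen.Rel.of _ _ ⟨e, f, g, h.1, h.2, rfl, rfl⟩
  have := (igCon S).eq.2 this
  exact congrArg _ this

theorem wordList_mul (v w : FreeSemigroup (IdemE S)) :
    wordList (v * w) = wordList v ++ wordList w := rfl

theorem wordVal_wordList (w : FreeSemigroup (IdemE S)) :
    wordVal (igGen S) (wordList w) = (igBar w : IG S) := by
  induction w using FreeSemigroup.recOnMul with
  | ih1 e => simp [wordList, igGen]
  | ih2 e w h h' => rw [wordList_mul, wordVal_append, h, h']; rfl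

theorem eqvGen_letterStep_append {E : Type*} {B : E → E → E → Prop} {l₁ l₂ l₃ l₄ : List E}
    (h : Relation.EqvGen (LetterStep B) l₁ l₂) (h' : Relation.EqvGen (LetterStep B) l₃ l₄) :
    Relation.EqvGen (LetterStep B) (l₁ ++ l₃) (l₂ ++ l₄) := by
  refine Relation.EqvGen.trans _ (l₂ ++ l₃) _ ?_ ?_
  · clear h'
    induction h with
    | rel l l' h =>
      obtain ⟨u, v, e, f, g, hB, rfl, rfl⟩ := h
      exact .rel _ _ ⟨u, v ++ l₃, e, f, g, hB, by simp, by simp⟩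
    | refl => exact .refl _
    | symm _ _ _ ih => exact ih.symm
    | trans _ _ _ _ _ ih ih' => exact ih.trans _ _ _ ih'
  · clear h
    induction h' with
    | rel l l' h =>
      obtain ⟨u, v, e, f, g, hB, rfl, rfl⟩ := h
      exact .rel _ _ ⟨l₂ ++ u, v, e, f, g, hB, by simp, by simp⟩
    | refl => exact .refl _
    | symm _ _ _ ih => exact ih.symm
    | trans _ _ _ _ _ ih ih' => exact ih.trans _ _ _ ih'

theorem eqvGen_letterStep_of_igCon {v w : FreeSemigroup (IdemE S)} (h : igCon S v w) :
    Relation.EqvGen (LetterStep igRelLetter) (wordList v) (wordList w) := by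
  have h' : ConGen.Rel (fun u v => igRelBase u v) v w := h
  clear h
  induction h' with
  | of _ _ h =>
    obtain ⟨e, f, g, hb, hg, rfl, rfl⟩ := h
    exact .rel _ _ ⟨[], [], e, f, g, ⟨hb, hg⟩, rfl, rfl⟩
  | refl => exact .refl _
  | symm _ ih => exact ih.symm
  | trans _ _ ih ih' => exact ih.trans _ _ _ ih'
  | mul _ _ ih ih' => exact eqvGen_letterStep_append ih ih'

theorem exists_wordList_eq {l : List (IdemE S)} (hl : l ≠ []) : ∃ w, wordList w = l := by
  cases l with
  | nil => exact absurd rfl hl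
  | cons e t => exact ⟨⟨e, t⟩, rfl⟩

theorem eqvGen_letterStep_of_wordVal_eq {l l' : List (IdemE S)}
    (h : wordVal (igGen S) l = wordVal (igGen S) l') :
    Relation.EqvGen (LetterStep igRelLetter) l l' := by
  rcases eq_or_ne l [] with rfl | hl <;> rcases eq_or_ne l' [] with rfl | hl'
  · exact .refl _
  · obtain ⟨w, rfl⟩ := exists_wordList_eq hl'
    rw [wordVal_wordList] at h
    exact absurd h.symm (WithOne.coe_ne_one)
  · obtain ⟨w, rfl⟩ := exists_wordList_eq hl
    rw [wordVal_wordList] at h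
    exact absurd h (WithOne.coe_ne_one)
  · obtain ⟨v, rfl⟩ := exists_wordList_eq hl
    obtain ⟨w, rfl⟩ := exists_wordList_eq hl'
    rw [wordVal_wordList, wordVal_wordList, WithOne.coe_inj] at h
    exact eqvGen_letterStep_of_igCon ((igCon S).eq.1 h)

/-- Words with the same value in `IG(E)` have the same value in `S`. -/
theorem wordVal_coe_eq {l l' : List (IdemE S)}
    (h : wordVal (igGen S) l = wordVal (igGen S) l') :
    wordVal (fun e : IdemE S => ((e : S) : WithOne S)) l =
      wordVal (fun e : IdemE S => ((e : S) : WithOne S)) l' := by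
  have hs := eqvGen_letterStep_of_wordVal_eq h
  clear h
  induction hs with
  | rel l l' h =>
    obtain ⟨u, v, e, f, g, ⟨-, hg⟩, rfl, rfl⟩ := h
    simp [hg, mul_assoc]
  | refl => rfl
  | symm _ _ _ ih => exact ih.symm
  | trans _ _ _ _ _ ih ih' => exact ih.trans ih'

theorem exists_wordVal_eq (a : IG S) :
    ∃ l ≠ [], wordVal (igGen S) l = (a : WithOne (IG S)) := by
  obtain ⟨w, rfl⟩ := Quotient.exists_rep a
  exact ⟨wordList w, by simp [wordList], wordVal_wordList w⟩

theorem exists_wordVal_eq_withOne (a : WithOne (IG S)) : ∃ l, wordVal (igGen S) l = a := by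
  cases a with
  | one => exact ⟨[], rfl⟩
  | coe a =>
    obtain ⟨l, -, hl⟩ := exists_wordVal_eq a
    exact ⟨l, hl⟩

theorem rightAssoc_igGen {e f : IdemE S} (h : (e : S) * f = f) (h' : (f : S) * e = e) :
    RightAssoc (igGen S e) (igGen S f) :=
  ⟨igGen S f, igGen S e, igGen_mul ⟨Or.inr (Or.inl h), h.symm⟩,
    igGen_mul ⟨Or.inr (Or.inl h'), h'.symm⟩⟩

theorem leftAssoc_igGen {e f : IdemE S} (h : (e : S) * f = e) (h' : (f : S) * e = f) :
    LeftAssoc (igGen S e) (igGen S f) :=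
  ⟨igGen S f, igGen S e, igGen_mul ⟨Or.inl h', h'.symm⟩, igGen_mul ⟨Or.inl h, h.symm⟩⟩

theorem igGen_left_letter (x e : IdemE S)
    (h : LeftAssoc (igGen S e) (igGen S x * igGen S e)) :
    ∃ g, RightAssoc (igGen S x * igGen S e) (igGen S g) := by
  obtain ⟨_, y, -, hy⟩ := h
  obtain ⟨l, rfl⟩ := exists_wordVal_eq_withOne y
  have hS := wordVal_coe_eq (l := l ++ [x, e]) (l' := [e]) (by simpa using hy)
  obtain ⟨z, hez, hz⟩ : ∃ z : S, (e : S) * z = z ∧ z * (x * e) = e := by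
    simp only [wordVal_append, wordVal_cons, wordVal_nil, mul_one] at hS
    generalize wordVal (fun e : IdemE S => ((e : S) : WithOne S)) l = Y at hS
    cases Y with
    | one =>
      refine ⟨e, e.2, ?_⟩
      simp only [one_mul, ← WithOne.coe_mul, WithOne.coe_inj] at hS
      rw [hS, e.2]
    | coe Y =>
      simp only [← WithOne.coe_mul, WithOne.coe_inj] at hS
      exact ⟨e * Y, by rw [← mul_assoc, e.2], by rw [mul_assoc, hS, e.2]⟩
  have hh : z * (x : S) * (z * x) = z * x := by
    calc z * (x : S) * (z * x) = z * x * (e * z * x) := by rw [hez]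
      _ = z * (x * e) * z * x := by simp only [mul_assoc]
      _ = z * x := by rw [hz, hez]
  have hhx : z * (x : S) * x = z * x := by rw [mul_assoc, x.2]
  have heh : (e : S) * (z * x) = z * x := by rw [← mul_assoc, hez]
  have hhe : z * (x : S) * e = e := by rw [mul_assoc, hz]
  have hg : (x : S) * (z * x) * (x * (z * x)) = x * (z * x) := by
    rw [mul_assoc, ← mul_assoc (z * (x : S)) x, hhx, hh]
  have h₁ : igGen S x * igGen S ⟨z * x, hh⟩ = igGen S ⟨x * (z * x), hg⟩ :=
    igGen_mul ⟨Or.inr (Or.inr (Or.inr hhx)), rfl⟩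
  have h₂ : igGen S e * igGen S ⟨z * x, hh⟩ = igGen S ⟨z * x, hh⟩ :=
    igGen_mul ⟨Or.inr (Or.inl heh), heh.symm⟩
  have h₃ : igGen S ⟨z * x, hh⟩ * igGen S e = igGen S e :=
    igGen_mul ⟨Or.inr (Or.inl hhe), hhe.symm⟩
  exact ⟨⟨x * (z * x), hg⟩, igGen S ⟨z * x, hh⟩, igGen S e, by rw [mul_assoc, h₂, h₁],
    by rw [← h₁, mul_assoc, h₃]⟩

theorem igGen_right_letter (x e : IdemE S)
    (h : RightAssoc (igGen S e) (igGen S e * igGen S x)) :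
    ∃ g, LeftAssoc (igGen S e * igGen S x) (igGen S g) := by
  obtain ⟨_, y, -, hy⟩ := h
  obtain ⟨l, rfl⟩ := exists_wordVal_eq_withOne y
  have hS := wordVal_coe_eq (l := [e, x] ++ l) (l' := [e]) (by simpa [mul_assoc] using hy)
  obtain ⟨z, hze, hz⟩ : ∃ z : S, z * (e : S) = z ∧ e * x * z = e := by
    simp only [wordVal_append, wordVal_cons, wordVal_nil, mul_one] at hS
    generalize wordVal (fun e : IdemE S => ((e : S) : WithOne S)) l = Y at hS
    cases Y with
    | one =>
      refine ⟨e, e.2, ?_⟩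
      simp only [mul_one, ← WithOne.coe_mul, WithOne.coe_inj] at hS
      rw [hS, e.2]
    | coe Y =>
      simp only [← WithOne.coe_mul, WithOne.coe_inj] at hS
      exact ⟨Y * e, by rw [mul_assoc, e.2], by rw [← mul_assoc, hS, e.2]⟩
  have hh : (x : S) * z * (x * z) = x * z := by
    calc (x : S) * z * (x * z) = x * (z * e) * (x * z) := by rw [hze]
      _ = x * (z * (e * x * z)) := by simp only [mul_assoc]
      _ = x * z := by rw [hz, hze]
  have hxh : (x : S) * (x * z) = x * z := by rw [← mul_assoc, x.2]
  have hhe : (x : S) * z * e = x * z := by rw [mul_assoc, hze]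
  have heh : (e : S) * (x * z) = e := by rw [← mul_assoc, hz]
  have hg : (x : S) * z * x * (x * z * x) = x * z * x := by
    rw [← mul_assoc, mul_assoc _ (x : S) (x * z), hxh, hh]
  have h₁ : igGen S ⟨x * z, hh⟩ * igGen S x = igGen S ⟨x * z * x, hg⟩ :=
    igGen_mul ⟨Or.inr (Or.inr (Or.inl hxh)), rfl⟩
  have h₂ : igGen S ⟨x * z, hh⟩ * igGen S e = igGen S ⟨x * z, hh⟩ :=
    igGen_mul ⟨Or.inl hhe, hhe.symm⟩
  have h₃ : igGen S e * igGen S ⟨x * z, hh⟩ = igGen S e :=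
    igGen_mul ⟨Or.inl heh, heh.symm⟩
  exact ⟨⟨x * z * x, hg⟩, igGen S ⟨x * z, hh⟩, igGen S e, by rw [← mul_assoc, h₂, h₁],
    by rw [← h₁, ← mul_assoc, h₃]⟩

variable (S) in
theorem igPresentation : IdemPresentation (igGen S) igRelLetter where
  idem e := igGen_mul ⟨Or.inl e.2, e.2.symm⟩
  rel := igGen_mul
  assoc := by
    rintro e f g ⟨h | h | h | h, hg⟩
    · obtain rfl : g = e := Subtype.ext (hg.trans h)
      exact Or.inl (RightAssoc.refl _)
    · obtain rfl : g = f := Subtype.ext (hg.trans h)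
      exact Or.inr (LeftAssoc.refl _)
    · left
      apply rightAssoc_igGen
      · rw [hg, ← mul_assoc, e.2]
      · rw [hg, mul_assoc, h, e.2]
    · right
      apply leftAssoc_igGen
      · rw [hg, ← mul_assoc, h, f.2]
      · rw [hg, mul_assoc, f.2]
  complete _ _ := eqvGen_letterStep_of_wordVal_eq
  surj := exists_wordVal_eq_withOne
  left_letter := igGen_left_letter
  right_letter := igGen_right_letter

end IGPresentation

theorem stmt15 {S : Type*} [Semigroup S] [Finite (IdemE S)] :
    (∀ a b c : IG S, RTilde a b → RTilde (c * a) (c * b)) ∧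
    (∀ a b c : IG S, LTilde a b → LTilde (a * c) (b * c)) := by
  constructor <;> intro a b c h <;> obtain ⟨l, hl, ha⟩ := exists_wordVal_eq a <;>
    obtain ⟨l', hl', hb⟩ := exists_wordVal_eq b
  · rw [← rTilde_coe_iff, ← ha, ← hb] at h
    rw [← rTilde_coe_iff, WithOne.coe_mul, WithOne.coe_mul, ← ha, ← hb]
    exact (igPresentation S).rTilde_mul_left hl hl' h c
  · rw [← lTilde_coe_iff, ← ha, ← hb] at h
    rw [← lTilde_coe_iff, WithOne.coe_mul, WithOne.coe_mul, ← ha, ← hb]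
    exact (igPresentation S).lTilde_mul_right hl hl' h c
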